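/- arXiv:1507.05454 — 3 statements merged into one kernel-verified Lean document; each statement's English description precedes it below -/
import Mathlib

section
/- Let A and B be atoms and let θ and η be substitutions such that Aθ = Bθ, (Dom(η) ∩ Var(B)) ∩ Dom(θ) = ∅, and Ran(η) ∩ Dom(θη) = ∅. Then Aθη = Bηθη (i.e., applying θ then η to A yields the same atom as applying η, then θ, then η to B). -/
/- A model of first-order terms/atoms (atoms are modeled as terms with a
distinguished top symbol) and finitely supported substitutions, following
the standard conventions of logic programming. -/

namespace Concolic

open FirstOrder Language

variable {L : FirstOrder.Language} {V : Type} [DecidableEq V]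

/-- A substitution: a map from variables to terms (the finite-support
condition is stated separately as `IsSubst`). -/
abbrev Subst (L : FirstOrder.Language) (V : Type) : Type _ := V → L.Term V

/-- The domain of a substitution: the variables it moves. -/
def dom (σ : Subst L V) : Set V := {x | σ x ≠ Term.var x}

/-- The set of variables of a term (or atom). -/
def vars (t : L.Term V) : Set V := ↑t.varFinset

/-- The range of a substitution: variables occurring in images of its domain. -/
def ran (σ : Subst L V) : Set V := ⋃ x ∈ dom σ, vars (σ x)

/-- Var(θ) = Dom(θ) ∪ Ran(θ). -/
def varsSubst (σ : Subst L V) : Set V := dom σ ∪ ran σ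

/-- Composition of substitutions: `comp θ η` applies θ first, then η. -/
def comp (θ η : Subst L V) : Subst L V := fun x => (θ x).subst η

/-- A substitution is finitely supported: identity on all but finitely many variables. -/
def IsSubst (σ : Subst L V) : Prop := (dom σ).Finite

/-- θ is idempotent if θθ = θ. -/
def Idempotent (σ : Subst L V) : Prop := comp σ σ = σ

/-- The substitution {X/t} mapping X to t and every other variable to itself. -/
def single (X : V) (t : L.Term V) : Subst L V := fun y => if y = X then t else Term.var y

/-- Atoms A and B are unifiable if Aσ = Bσ for some substitution σ. -/
def Unifiable (A B : L.Term V) : Prop := ∃ σ : Subst L V, IsSubst σ ∧ A.subst σ = B.subst σ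

/-- s₁ is more general than s₂ (s₁ ≤ s₂) if s₁θ = s₂ for some substitution θ. -/
def MoreGen (s₁ s₂ : L.Term V) : Prop := ∃ σ : Subst L V, IsSubst σ ∧ s₁.subst σ = s₂

/-- σ is a most general unifier of A and H. -/
def IsMGU (σ : Subst L V) (A H : L.Term V) : Prop :=
  IsSubst σ ∧ A.subst σ = H.subst σ ∧
    ∀ θ : Subst L V, IsSubst θ → A.subst θ = H.subst θ →
      ∃ δ : Subst L V, IsSubst δ ∧ θ = comp σ δ

/-- The variables of a set of atoms. -/
def varsSet (𝓑 : Set (L.Term V)) : Set V := ⋃ B ∈ 𝓑, vars B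

/-- A term is ground if it contains no variables. -/
def Ground (t : L.Term V) : Prop := t.varFinset = ∅

end Concolic

namespace Concolic

theorem subst_comp {L : FirstOrder.Language} {V : Type} (t : L.Term V) (θ η : Subst L V) :
    t.subst (comp θ η) = (t.subst θ).subst η := by
  induction t with
  | var x => rfl
  | func f ts ih => simp [FirstOrder.Language.Term.subst, ih]

theorem subst_congr {L : FirstOrder.Language} {V : Type} [DecidableEq V] (t : L.Term V)
    {σ τ : Subst L V} (h : ∀ x ∈ vars t, σ x = τ x) : t.subst σ = t.subst τ := by
  induction t with
  | var x => exact h x (by simp [vars, FirstOrder.Language.Term.varFinset])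
  | func f ts ih =>
    simp only [FirstOrder.Language.Term.subst]
    congr 1
    funext i
    refine ih i fun x hx => h x ?_
    simp only [vars, FirstOrder.Language.Term.varFinset, Finset.mem_coe, Finset.mem_biUnion,
      Finset.mem_univ, true_and] at hx ⊢
    exact ⟨i, hx⟩

theorem subst_var {L : FirstOrder.Language} {V : Type} (t : L.Term V) :
    t.subst FirstOrder.Language.Term.var = t := by
  induction t with
  | var x => rfl
  | func f ts ih => simp [FirstOrder.Language.Term.subst, ih]

/-- A substitution whose domain avoids the variables of a term fixes that term. -/
theorem subst_eq_self {L : FirstOrder.Language} {V : Type} [DecidableEq V] {t : L.Term V}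
    {σ : Subst L V} (h : ∀ x ∈ vars t, x ∉ dom σ) : t.subst σ = t :=
  (subst_congr t fun x hx => not_not.mp (h x hx)).trans (subst_var t)

/-- If Aθ = Bθ, (Dom(η) ∩ Var(B)) ∩ Dom(θ) = ∅ and
Ran(η) ∩ Dom(θη) = ∅, then Aθη = Bηθη. -/
theorem stmt0 {L : FirstOrder.Language} {V : Type} [DecidableEq V]
    (A B : L.Term V) (θ η : Subst L V)
    (hθ : IsSubst θ) (hη : IsSubst η)
    (hAB : A.subst θ = B.subst θ)
    (h1 : (dom η ∩ vars B) ∩ dom θ = ∅)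
    (h2 : ran η ∩ dom (comp θ η) = ∅) :
    (A.subst θ).subst η = ((B.subst η).subst θ).subst η := by
  rw [hAB, ← subst_comp, ← subst_comp, ← subst_comp]
  refine subst_congr B fun x hxB => ?_
  by_cases hx : x ∈ dom η
  · have hθx : θ x = FirstOrder.Language.Term.var x := by
      by_contra hne
      exact (Set.eq_empty_iff_forall_notMem.mp h1 x) ⟨⟨hx, hxB⟩, hne⟩
    have hfix : (η x).subst (comp θ η) = η x := subst_eq_self fun y hy hyd =>
      Set.eq_empty_iff_forall_notMem.mp h2 y ⟨Set.mem_biUnion hx hy, hyd⟩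
    calc comp θ η x = η x := by simp [comp, hθx, FirstOrder.Language.Term.subst]
      _ = comp η (comp θ η) x := hfix.symm
  · have hηx : η x = FirstOrder.Language.Term.var x := not_not.mp hx
    simp [comp, hηx, FirstOrder.Language.Term.subst]

end Concolic
end

section
/- Let 𝒰 be a set of variables, 𝓑 a finite set of atoms, B₁, B₂ ∈ 𝓑, t and t′ terms, and U ∈ 𝒰 a variable with U ∉ Var(𝓑) ∪ Var(t) ∪ Var(t′). Let C₁ and C₂ be atoms with C₁{U/t} = B₁, C₂{U/t′} = B₂, Var(C₁) ⊆ Var(B₁) ∪ {U}, and Var(C₂) ⊆ Var(B₂) ∪ {U}; set 𝓑′ = (𝓑 ∖ {B₁, B₂}) ∪ {C₁, C₂}. If A′ is an atom with U ∉ Var(A′), B ∈ 𝓑, and θ is a substitution with A′θ = Bθ and Var(𝓑) ∩ Dom(θ) ⊆ 𝒰, then there exist B″ ∈ 𝓑′ and a substitution θ″ with A′θ″ = B″θ″ and Var(𝓑′) ∩ Dom(θ″) ⊆ 𝒰. (This is the preservation, under one generalization step replacing a disagreement pair by a fresh variable of 𝒰, of the invariant: for each atom A′ of the input there exist B ∈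 𝓑 and a substitution θ with A′θ = Bθ and Var(𝓑) ∩ Dom(θ) ⊆ 𝒰.) -/
namespace Concolic

open FirstOrder Language in
/-- Substitution depends only on the values at the variables that occur in the term. -/
theorem subst_congr_of_vars {L : FirstOrder.Language} {V : Type} [DecidableEq V]
    {σ τ : Subst L V} (s : L.Term V) (h : ∀ x ∈ vars s, σ x = τ x) :
    s.subst σ = s.subst τ := by
  induction s with
  | var x => exact h x (by simp [vars])
  | func f ts ih =>
    simp only [Term.subst]
    congr 1
    funext i
    refine ih i fun x hx => h x ?_
    simp only [vars, Term.varFinset, Finset.mem_coe, Finset.mem_biUnion, Finset.mem_univ,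
      true_and]
    exact ⟨i, hx⟩

open FirstOrder Language in
/-- Substituting `t` for `U` and then applying `θ` amounts to redirecting `θ` at `U`. -/
theorem subst_single_subst {L : FirstOrder.Language} {V : Type} [DecidableEq V]
    (s t : L.Term V) (U : V) (θ : Subst L V) :
    (s.subst (single U t)).subst θ = s.subst (Function.update θ U (t.subst θ)) := by
  induction s with
  | var x =>
    by_cases hx : x = U
    · subst hx
      simp [single, Term.subst]
    · simp [single, Term.subst, hx]
  | func f ts ih =>
    simp only [Term.subst]
    congr 1
    funext i
    exact ih i

theorem dom_update_subset {L : FirstOrder.Language} {V : Type} [DecidableEq V]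
    (θ : Subst L V) (U : V) (s : L.Term V) :
    dom (Function.update θ U s) ⊆ insert U (dom θ) := by
  intro x hx
  by_cases h : x = U
  · exact Or.inl h
  · exact Or.inr (by simpa [dom, h] using hx)

/-- preservation of the invariant under one generalization step
replacing a disagreement pair t, t′ by a fresh variable U ∈ 𝒰. -/
theorem stmt4 {L : FirstOrder.Language} {V : Type} [DecidableEq V]
    (𝒰 : Set V) (𝓑 : Set (L.Term V)) (hfin : 𝓑.Finite)
    (B₁ B₂ : L.Term V) (hB₁ : B₁ ∈ 𝓑) (hB₂ : B₂ ∈ 𝓑)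
    (t t' : L.Term V) (U : V) (hU𝒰 : U ∈ 𝒰)
    (hUfresh : U ∉ varsSet 𝓑 ∪ vars t ∪ vars t')
    (C₁ C₂ : L.Term V)
    (hC₁ : C₁.subst (single U t) = B₁) (hC₂ : C₂.subst (single U t') = B₂)
    (hvC₁ : vars C₁ ⊆ vars B₁ ∪ {U}) (hvC₂ : vars C₂ ⊆ vars B₂ ∪ {U})
    (A' : L.Term V) (hUA' : U ∉ vars A')
    (B : L.Term V) (hB : B ∈ 𝓑)
    (θ : Subst L V) (hθ : IsSubst θ)
    (hunif : A'.subst θ = B.subst θ)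
    (hdom : varsSet 𝓑 ∩ dom θ ⊆ 𝒰) :
    ∃ B'' ∈ (𝓑 \ {B₁, B₂}) ∪ {C₁, C₂}, ∃ θ'' : Subst L V,
      IsSubst θ'' ∧ A'.subst θ'' = B''.subst θ'' ∧
        varsSet ((𝓑 \ {B₁, B₂}) ∪ {C₁, C₂}) ∩ dom θ'' ⊆ 𝒰 := by
  have hvars : varsSet ((𝓑 \ {B₁, B₂}) ∪ {C₁, C₂}) ⊆ insert U (varsSet 𝓑) := by
    intro x hx
    simp only [varsSet, Set.mem_iUnion, exists_prop] at hx
    obtain ⟨D, hD, hx⟩ := hx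
    have key : ∀ E ∈ 𝓑, x ∈ vars E ∪ {U} → x ∈ insert U (varsSet 𝓑) := by
      rintro E hE (h | h)
      · exact Or.inr (Set.mem_biUnion hE h)
      · exact Or.inl h
    rcases hD with hD | rfl | rfl
    · exact key D hD.1 (Or.inl hx)
    · exact key B₁ hB₁ (hvC₁ hx)
    · exact key B₂ hB₂ (hvC₂ hx)
  have hsub : ∀ σ : Subst L V, dom σ ⊆ insert U (dom θ) →
      varsSet ((𝓑 \ {B₁, B₂}) ∪ {C₁, C₂}) ∩ dom σ ⊆ 𝒰 := by
    rintro σ hσ x ⟨hx, hxσ⟩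
    rcases hvars hx with rfl | hx
    · exact hU𝒰
    · rcases hσ hxσ with rfl | hxθ
      · exact hU𝒰
      · exact hdom ⟨hx, hxθ⟩
  have hgen : ∀ C s : L.Term V, C.subst (single U s) = B → ∃ θ'' : Subst L V,
      IsSubst θ'' ∧ A'.subst θ'' = C.subst θ'' ∧
        varsSet ((𝓑 \ {B₁, B₂}) ∪ {C₁, C₂}) ∩ dom θ'' ⊆ 𝒰 := by
    intro C s hC
    refine ⟨Function.update θ U (s.subst θ),
      (hθ.insert U).subset (dom_update_subset θ U _), ?_, hsub _ (dom_update_subset θ U _)⟩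
    rw [← subst_single_subst C, hC, ← hunif]
    refine subst_congr_of_vars A' fun x hx => Function.update_of_ne ?_ _ _
    rintro rfl
    exact hUA' hx
  by_cases h₁ : B = B₁
  · exact ⟨C₁, by simp, hgen C₁ t (hC₁.trans h₁.symm)⟩
  by_cases h₂ : B = B₂
  · exact ⟨C₂, by simp, hgen C₂ t' (hC₂.trans h₂.symm)⟩
  exact ⟨B, Or.inl ⟨hB, by simp [h₁, h₂]⟩, θ, hθ, hunif, hsub θ (Set.subset_insert _ _)⟩

end Concolic
end

section
/- Let 𝒰 be a set of variables, B and B′ atoms, and θ′ a substitution with Bθ′ = B′θ′ and Var(B) ∩ Dom(θ′) ⊆ 𝒰. Let η be an idempotent substitution with Dom(η) ⊆ Var(B), Var(η) ∩ 𝒰 = ∅, and Ran(η) ∩ Dom(θ′η) = ∅. Then (Bη)(θ′η) = B′(θ′η); in particular, Bη and B′ are unifiable. -/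
namespace Concolic

theorem subst_subst {L : FirstOrder.Language} {V : Type} (t : L.Term V) (σ τ : Subst L V) :
    (t.subst σ).subst τ = t.subst (comp σ τ) := by
  induction t with
  | var x => rfl
  | func f ts ih => simp only [FirstOrder.Language.Term.subst, ih]

theorem subst_eq_self_of_disjoint {L : FirstOrder.Language} {V : Type} [DecidableEq V]
    (t : L.Term V) (σ : Subst L V) (h : ∀ x ∈ vars t, x ∉ dom σ) : t.subst σ = t := by
  induction t with
  | var x =>
    have hx := h x (by simp [vars, FirstOrder.Language.Term.varFinset])
    simpa [dom] using hx
  | func f ts ih =>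
    simp only [FirstOrder.Language.Term.subst]
    congr 1
    funext i
    refine ih i fun x hx => h x ?_
    simp only [vars, FirstOrder.Language.Term.varFinset, Finset.coe_biUnion, Set.mem_iUnion]
    exact ⟨i, by simp, hx⟩

theorem IsSubst.comp {L : FirstOrder.Language} {V : Type} {σ τ : Subst L V}
    (hσ : IsSubst σ) (hτ : IsSubst τ) : IsSubst (comp σ τ) := by
  refine (Set.Finite.union hσ hτ).subset fun x hx => ?_
  by_contra hn
  simp only [dom, Set.mem_union, Set.mem_ofPred_eq, not_or, not_not] at hn
  exact hx (by simp [Concolic.comp, hn.1, hn.2])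

/-- if Bθ′ = B′θ′ with Var(B) ∩ Dom(θ′) ⊆ 𝒰 and η is an idempotent
substitution with Dom(η) ⊆ Var(B), Var(η) ∩ 𝒰 = ∅ and Ran(η) ∩ Dom(θ′η) = ∅,
then Bη(θ′η) = B′(θ′η); in particular Bη and B′ are unifiable. -/
theorem stmt6 {L : FirstOrder.Language} {V : Type} [DecidableEq V]
    (𝒰 : Set V) (B B' : L.Term V)
    (θ' : Subst L V) (hθ'fin : IsSubst θ')
    (hunif : B.subst θ' = B'.subst θ')
    (hdom : vars B ∩ dom θ' ⊆ 𝒰)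
    (η : Subst L V) (hηfin : IsSubst η) (hidem : Idempotent η)
    (hdomη : dom η ⊆ vars B) (hvarη : varsSubst η ∩ 𝒰 = ∅)
    (hran : ran η ∩ dom (comp θ' η) = ∅) :
    (B.subst η).subst (comp θ' η) = B'.subst (comp θ' η) ∧
      Unifiable (B.subst η) B' := by
  have key : comp η (comp θ' η) = comp θ' η := by
    funext x
    by_cases hx : x ∈ dom η
    · have hxθ : θ' x = FirstOrder.Language.Term.var x := by
        by_contra hne
        exact (Set.eq_empty_iff_forall_notMem.mp hvarη) x ⟨Or.inl hx, hdom ⟨hdomη hx, hne⟩⟩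
      have hfix : (η x).subst (comp θ' η) = η x :=
        subst_eq_self_of_disjoint _ _ fun y hy hyd =>
          (Set.eq_empty_iff_forall_notMem.mp hran) y ⟨Set.mem_biUnion hx hy, hyd⟩
      change (η x).subst (comp θ' η) = (θ' x).subst η
      rw [hfix, hxθ]
      rfl
    · have hηx : η x = FirstOrder.Language.Term.var x := not_not.mp hx
      change (η x).subst (comp θ' η) = comp θ' η x
      rw [hηx]
      rfl
  have heq : (B.subst η).subst (comp θ' η) = B'.subst (comp θ' η) := by
    rw [subst_subst, key, ← subst_subst, ← subst_subst, hunif]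
  exact ⟨heq, comp θ' η, hθ'fin.comp hηfin, heq⟩

end Concolic
end
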